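/- For every positive integer k and every finite simple graph S, there exist a finite simple graph G containing S as an induced subgraph and an initial configuration C_0 on G such that the 1/2-power index process started from C_0 is eventually periodic with period at least k. -/

import Mathlib

open scoped Classical

/-- A strategy of a voter: collaborator (`C`) or defector (`D`). -/
inductive Strategy : Type
  | C : Strategy
  | D : Strategy
deriving DecidableEq

noncomputable section

variable {V : Type*}

/-- The closed neighbourhood `N[v]` of a vertex, as a finset. -/
def closedNbhd (G : SimpleGraph V) [Fintype V] (v : V) : Finset V :=
  Finset.univ.filter fun u => u = v ∨ G.Adj u v

/-- The (Shapley–Shubik style) power of a vertex `v` in configuration `c`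
with win condition `w`. -/
def power (G : SimpleGraph V) [Fintype V] (w : ℝ) (c : V → Strategy) (v : V) : ℝ :=
  let N := closedNbhd G v
  let nC := (N.filter fun u => c u = Strategy.C).card
  let nD := (N.filter fun u => c u = Strategy.D).card
  match c v with
  | Strategy.C => if w < (nC : ℝ) / (N.card : ℝ) then 1 / (nC : ℝ) else 0
  | Strategy.D => if (nC : ℝ) / (N.card : ℝ) ≤ w then 1 / (nD : ℝ) else 0

/-- One step of the `w`-power index process: every vertex adopts the strategy of a
vertex of maximum power in its closed neighbourhood, retaining its own strategy if
vertices of maximum power have differing strategies. -/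
def step (G : SimpleGraph V) [Fintype V] (w : ℝ) (c : V → Strategy) (v : V) : Strategy :=
  let N := closedNbhd G v
  let M := N.filter fun u => ∀ x ∈ N, power G w c x ≤ power G w c u
  if ∀ u ∈ M, c u = Strategy.C then Strategy.C
  else if ∀ u ∈ M, c u = Strategy.D then Strategy.D
  else c v

/-- `configSeq G w c0 i` is the configuration `C_i` of the `w`-power index process. -/
def configSeq (G : SimpleGraph V) [Fintype V] (w : ℝ) (c0 : V → Strategy) : ℕ → V → Strategy
  | 0 => c0
  | k + 1 => step G w (configSeq G w c0 k)

/-- The process is eventually stable. -/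
def EventuallyStable (G : SimpleGraph V) [Fintype V] (w : ℝ) (c0 : V → Strategy) : Prop :=
  ∃ i, configSeq G w c0 (i + 1) = configSeq G w c0 i

/-- The process reaches a stable all-collaborator configuration. -/
def CollaboratorDominant (G : SimpleGraph V) [Fintype V] (w : ℝ) (c0 : V → Strategy) : Prop :=
  ∃ i, configSeq G w c0 (i + 1) = configSeq G w c0 i ∧
    ∀ v, configSeq G w c0 i v = Strategy.C

/-- The process reaches a stable all-defector configuration. -/
def DefectorDominant (G : SimpleGraph V) [Fintype V] (w : ℝ) (c0 : V → Strategy) : Prop :=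
  ∃ i, configSeq G w c0 (i + 1) = configSeq G w c0 i ∧
    ∀ v, configSeq G w c0 i v = Strategy.D

/-- The process is eventually periodic with period `ℓ`: `ℓ > 1` is the least integer
such that `C_i = C_{i+ℓ}` for some `i ≥ 0`. -/
def EventuallyPeriodicWithPeriod (G : SimpleGraph V) [Fintype V] (w : ℝ)
    (c0 : V → Strategy) (ℓ : ℕ) : Prop :=
  IsLeast {m : ℕ | 1 < m ∧ ∃ i, configSeq G w c0 (i + m) = configSeq G w c0 i} ℓ

end

/-! ### Transport of the dynamics along an embedding onto a union of components -/

theorem power_emb {V W : Type*} [Fintype V] [Fintype W] (G : SimpleGraph V) (H : SimpleGraph W)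
    (f : V ↪ W) (h : ∀ v, closedNbhd H (f v) = (closedNbhd G v).map f) (w : ℝ)
    (c : W → Strategy) (v : V) : power H w c (f v) = power G w (fun x => c (f x)) v := by
  unfold power
  simp only [h, Finset.filter_map, Finset.card_map, Function.comp_def]

theorem step_emb {V W : Type*} [Fintype V] [Fintype W] (G : SimpleGraph V) (H : SimpleGraph W)
    (f : V ↪ W) (h : ∀ v, closedNbhd H (f v) = (closedNbhd G v).map f) (w : ℝ)
    (c : W → Strategy) (v : V) : step H w c (f v) = step G w (fun x => c (f x)) v := by
  unfold step
  simp only [h, Finset.mem_filter, Finset.mem_map, and_imp, forall_exists_index,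
    forall_apply_eq_imp_iff₂, power_emb G H f h]

theorem configSeq_emb {V W : Type*} [Fintype V] [Fintype W] (G : SimpleGraph V)
    (H : SimpleGraph W) (f : V ↪ W)
    (h : ∀ v, closedNbhd H (f v) = (closedNbhd G v).map f) (w : ℝ)
    (c : W → Strategy) (t : ℕ) :
    (fun v => configSeq H w c t (f v)) = configSeq G w (fun x => c (f x)) t := by
  induction t with
  | zero => rfl
  | succ t ih =>
    funext v
    simp only [configSeq]
    rw [step_emb G H f h, ih]

/-! ### The ring graph: a triangle times a cycle -/

/-- Strategy encoded by a Boolean. -/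
def toS (b : Bool) : Strategy := if b then Strategy.C else Strategy.D

theorem toS_C (b : Bool) : toS b = Strategy.C ↔ b = true := by cases b <;> simp [toS]

theorem toS_D (b : Bool) : toS b = Strategy.D ↔ b = false := by cases b <;> simp [toS]

/-- The product of a triangle and a cycle of length `n`. -/
def ring3 (n : ℕ) : SimpleGraph (ZMod n × Fin 3) where
  Adj p q := p ≠ q ∧ (p.1 = q.1 ∨ p.2 = q.2 ∧ (p.1 = q.1 + 1 ∨ q.1 = p.1 + 1))
  symm := ⟨by
    rintro p q ⟨h, h1⟩
    refine ⟨h.symm, ?_⟩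
    rcases h1 with h1 | ⟨h1, h2⟩
    · exact Or.inl h1.symm
    · exact Or.inr ⟨h1.symm, h2.symm⟩⟩
  loopless := ⟨fun p hp => hp.1 rfl⟩

/-- Closed neighbourhood as a list of vertices. -/
def nbs {n : ℕ} (v : ZMod n × Fin 3) : List (ZMod n × Fin 3) :=
  [(v.1, 0), (v.1, 1), (v.1, 2), (v.1 + 1, v.2), (v.1 - 1, v.2)]

theorem mem_closedNbhd' {V : Type*} [Fintype V] (G : SimpleGraph V) (u v : V) :
    u ∈ closedNbhd G v ↔ u = v ∨ G.Adj u v := by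
  simp [closedNbhd]

theorem mem_closedNbhd_ring (n : ℕ) [NeZero n] (v u : ZMod n × Fin 3) :
    u ∈ closedNbhd (ring3 n) v ↔ u ∈ nbs v := by
  obtain ⟨i, a⟩ := v
  obtain ⟨j, b⟩ := u
  rw [mem_closedNbhd']
  simp only [ring3, nbs, List.mem_cons, Prod.mk.injEq, List.not_mem_nil, or_false]
  have hb : b = 0 ∨ b = 1 ∨ b = 2 := by fin_cases b <;> simp
  have e : i = j + 1 ↔ j = i - 1 := by
    constructor
    · rintro rfl; ring
    · rintro rfl; ring
  rw [e]
  have hij : j = i ∧ b = a → j = i := fun h => h.1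
  simp only [ne_eq, Prod.mk.injEq]
  clear e
  tauto

theorem nbs_nodup (n : ℕ) (hn : 10 ≤ n) (v : ZMod n × Fin 3) : (nbs v).Nodup := by
  have h1 : (1 : ZMod n) ≠ 0 := by
    intro h
    have h' : ((1 : ℕ) : ZMod n) = 0 := by exact_mod_cast h
    rw [ZMod.natCast_eq_zero_iff] at h'
    have := Nat.le_of_dvd (by norm_num) h'
    omega
  have h2 : (2 : ZMod n) ≠ 0 := by
    intro h
    have h' : ((2 : ℕ) : ZMod n) = 0 := by exact_mod_cast h
    rw [ZMod.natCast_eq_zero_iff] at h'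
    have := Nat.le_of_dvd (by norm_num) h'
    omega
  obtain ⟨i, a⟩ := v
  have h3 : i + 1 ≠ i - 1 := by
    intro h
    apply h2
    linear_combination h
  have h4 : i ≠ i - 1 := by
    intro h
    apply h1
    linear_combination h
  simp [nbs, h1, h3, h4]

theorem closedNbhd_ring (n : ℕ) [NeZero n] (v : ZMod n × Fin 3) :
    closedNbhd (ring3 n) v = (nbs v).toFinset := by
  ext u
  rw [mem_closedNbhd_ring, List.mem_toFinset]

/-- Sixty times the power, computed locally. -/
def pw (o b0 b1 b2 b3 b4 : Bool) : ℕ :=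
  match [b0, b1, b2, b3, b4].count o with
  | 3 => 20
  | 4 => 15
  | 5 => 12
  | _ => 0

/-- Local power at a vertex. -/
def pwv {n : ℕ} (β : ZMod n × Fin 3 → Bool) (v : ZMod n × Fin 3) : ℕ :=
  pw (β v) (β (v.1, 0)) (β (v.1, 1)) (β (v.1, 2)) (β (v.1 + 1, v.2)) (β (v.1 - 1, v.2))

theorem card_filter_list {α : Type*} [DecidableEq α] (l : List α) (hl : l.Nodup)
    (p : α → Prop) [DecidablePred p] (q : α → Bool) (hpq : ∀ x, p x ↔ q x = true) :
    (l.toFinset.filter p).card = l.countP q := by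
  have h : l.toFinset.filter p = (l.filter q).toFinset := by
    ext x
    simp [hpq]
  rw [h, List.toFinset_card_of_nodup (hl.filter _), List.countP_eq_length_filter]

theorem power_ring (n : ℕ) [NeZero n] (hn : 10 ≤ n) (β : ZMod n × Fin 3 → Bool)
    (v : ZMod n × Fin 3) :
    power (ring3 n) (1 / 2) (fun x => toS (β x)) v = (pwv β v : ℝ) / 60 := by
  unfold power
  have hc : ((nbs v).toFinset).card = 5 := by
    rw [List.toFinset_card_of_nodup (nbs_nodup n hn v)]; rfl
  simp only [closedNbhd_ring, hc]
  rw [card_filter_list _ (nbs_nodup n hn v) _ (fun x => β x) (fun x => toS_C _),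
    card_filter_list _ (nbs_nodup n hn v) _ (fun x => !β x) (fun x => by rw [toS_D]; simp)]
  have hv : β v = β (v.1, 0) ∨ β v = β (v.1, 1) ∨ β v = β (v.1, 2) := by
    obtain ⟨i, a⟩ := v
    fin_cases a <;> simp
  unfold pwv nbs
  simp only [List.countP_cons, List.countP_nil]
  generalize β (v.1, 0) = b0 at *
  generalize β (v.1, 1) = b1 at *
  generalize β (v.1, 2) = b2 at *
  generalize β (v.1 + 1, v.2) = b3 at *
  generalize β (v.1 - 1, v.2) = b4 at *
  generalize β v = o at *
  cases o <;> cases b0 <;> cases b1 <;> cases b2 <;> cases b3 <;> cases b4 <;>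
    first
    | (exfalso; revert hv; decide)
    | (norm_num [toS, pw])

/-- Local update from the list of (state, power) pairs. -/
def sl (o : Bool) (L : List (Bool × ℕ)) : Bool :=
  if (∀ u ∈ L, (∀ x ∈ L, x.2 ≤ u.2) → u.1 = true) then true
  else if (∀ u ∈ L, (∀ x ∈ L, x.2 ≤ u.2) → u.1 = false) then false
  else o

theorem step_ring (n : ℕ) [NeZero n] (hn : 10 ≤ n) (β : ZMod n × Fin 3 → Bool)
    (v : ZMod n × Fin 3) :
    step (ring3 n) (1 / 2) (fun x => toS (β x)) v =
      toS (sl (β v) ((nbs v).map fun u => (β u, pwv β u))) := by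
  have hle : ∀ x u, ((pwv β x : ℝ) / 60 ≤ (pwv β u : ℝ) / 60) ↔ pwv β x ≤ pwv β u := by
    intro x u
    rw [div_le_div_iff_of_pos_right (by norm_num : (0 : ℝ) < 60)]
    exact Nat.cast_le
  unfold step sl
  simp only [Finset.mem_filter, mem_closedNbhd_ring, power_ring n hn, hle, and_imp, toS_C, toS_D,
    List.mem_map, forall_exists_index, forall_apply_eq_imp_iff₂]
  split_ifs <;> simp [toS]

/-- Update computed from a window. -/
def loc (w : ℤ → Fin 3 → Bool) (a : Fin 3) : Bool :=
  sl (w 0 a) (([(0, 0), (0, 1), (0, 2), (1, a), (-1, a)] : List (ℤ × Fin 3)).map fun u =>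
    (w u.1 u.2, pw (w u.1 u.2) (w u.1 0) (w u.1 1) (w u.1 2) (w (u.1 + 1) u.2) (w (u.1 - 1) u.2)))

theorem step_loc (n : ℕ) [NeZero n] (hn : 10 ≤ n) (β : ZMod n × Fin 3 → Bool)
    (i : ZMod n) (a : Fin 3) :
    step (ring3 n) (1 / 2) (fun x => toS (β x)) (i, a) =
      toS (loc (fun d b => β (i + (d : ZMod n), b)) a) := by
  rw [step_ring n hn]
  unfold loc nbs pwv
  simp only [List.map_cons, List.map_nil, Int.cast_add, Int.cast_sub, Int.cast_zero, Int.cast_one,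
    Int.cast_neg, add_zero, ← sub_eq_add_neg, ← add_assoc, ← add_sub_assoc]

/-- The glider pattern on the integers. -/
def pat (m : ℤ) (a : Fin 3) : Bool :=
  if m = 4 then decide (a ≠ 0)
  else if m = 5 then true
  else if m = 6 then true
  else if m = 7 then decide (a = 0)
  else false

theorem pat_far (m : ℤ) (h : m < 4 ∨ 7 < m) : pat m = fun _ => false := by
  funext a
  unfold pat
  split_ifs <;> first | omega | rfl

theorem loc_congr (w w' : ℤ → Fin 3 → Bool) (h : ∀ d, -2 ≤ d → d ≤ 2 → w d = w' d) (a : Fin 3) :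
    loc w a = loc w' a := by
  unfold loc
  have h0 := h 0 (by norm_num) (by norm_num)
  have h1 := h 1 (by norm_num) (by norm_num)
  have h2 := h 2 (by norm_num) (by norm_num)
  have h3 := h (-1) (by norm_num) (by norm_num)
  have h4 := h (-2) (by norm_num) (by norm_num)
  norm_num [h0, h1, h2, h3, h4]

theorem loc_false : ∀ a, loc (fun _ _ => false) a = false := by decide

theorem loc_near : ∀ k : Fin 8, ∀ a, loc (fun d => pat (2 + (k : ℕ) + d)) a = pat (2 + (k : ℕ) + 1) a := by
  decide

theorem loc_pat (m : ℤ) (a : Fin 3) : loc (fun d => pat (m + d)) a = pat (m + 1) a := by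
  by_cases h : 2 ≤ m ∧ m ≤ 9
  · have := loc_near ⟨(m - 2).toNat, by omega⟩ a
    have e : (2 : ℤ) + ((m - 2).toNat : ℕ) = m := by omega
    simpa only [e] using this
  · rw [pat_far (m + 1) (by omega), ← loc_false a]
    apply loc_congr
    intro d h1 h2
    exact pat_far _ (by omega)

/-- The glider on the ring. -/
def glider (n : ℕ) (v : ZMod n × Fin 3) : Bool := pat (v.1.val : ℤ) v.2

theorem glider_cast (n : ℕ) [NeZero n] (hn : 10 ≤ n) (m : ℤ) (h1 : -2 ≤ m) (h2 : m ≤ n + 1)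
    (a : Fin 3) : glider n ((m : ZMod n), a) = pat m a := by
  unfold glider
  simp only [ZMod.val_intCast]
  have hr : m % n = m ∨ m % n = m + n ∨ m % n = m - n := by
    rcases lt_or_ge m 0 with h | h
    · right; left
      rw [← Int.add_emod_right]
      exact Int.emod_eq_of_lt (by omega) (by omega)
    · rcases lt_or_ge m n with h' | h'
      · left; exact Int.emod_eq_of_lt h h'
      · right; right
        rw [← Int.sub_emod_right]
        exact Int.emod_eq_of_lt (by omega) (by omega)
  have p1 := Int.emod_nonneg m (by omega : (n : ℤ) ≠ 0)
  have p2 := Int.emod_lt_of_pos m (by omega : (0 : ℤ) < n)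
  by_cases h : m % n = m
  · rw [h]
  · rw [pat_far m (by omega), pat_far (m % n) (by omega)]

theorem step_glider (n : ℕ) [NeZero n] (hn : 10 ≤ n) (s : ZMod n) :
    step (ring3 n) (1 / 2) (fun x => toS (glider n (x.1 + s, x.2))) =
      fun x => toS (glider n (x.1 + (s + 1), x.2)) := by
  funext ⟨i, a⟩
  rw [step_loc n hn (fun x => glider n (x.1 + s, x.2))]
  congr 1
  have hx : (((i + s).val : ℤ) : ZMod n) = i + s := by simp
  have hlt := ZMod.val_lt (i + s)
  have e2 : i + (s + 1) = ((((i + s).val : ℤ) + 1 : ℤ) : ZMod n) := by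
    rw [Int.cast_add, hx]; push_cast; ring
  simp only
  rw [e2, glider_cast n hn _ (by omega) (by omega), ← loc_pat]
  apply loc_congr
  intro d h1 h2
  funext b
  have e1 : i + (d : ZMod n) + s = ((((i + s).val : ℤ) + d : ℤ) : ZMod n) := by
    rw [Int.cast_add, hx]; ring
  rw [e1, glider_cast n hn _ (by omega) (by omega)]

theorem config_glider (n : ℕ) [NeZero n] (hn : 10 ≤ n) (t : ℕ) :
    configSeq (ring3 n) (1 / 2) (fun x => toS (glider n x)) t =
      fun x => toS (glider n (x.1 + (t : ZMod n), x.2)) := by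
  induction t with
  | zero => funext x; simp [configSeq]
  | succ t ih =>
    simp only [configSeq]
    rw [ih, step_glider n hn]
    push_cast
    rfl

theorem glider_period (n : ℕ) [NeZero n] (hn : 10 ≤ n) (i m : ℕ)
    (h : configSeq (ring3 n) (1 / 2) (fun x => toS (glider n x)) (i + m) =
      configSeq (ring3 n) (1 / 2) (fun x => toS (glider n x)) i) : n ∣ m := by
  rw [config_glider n hn, config_glider n hn] at h
  have key : ∀ a, glider n ((4 : ZMod n) + (m : ZMod n), a) = pat 4 a := by
    intro a
    have h1 := congrFun h ((4 : ZMod n) - i, a)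
    have h2 : ∀ b b', toS b = toS b' → b = b' := by decide
    have h3 := h2 _ _ h1
    have e1 : (4 : ZMod n) - i + ((i + m : ℕ) : ZMod n) = 4 + (m : ZMod n) := by push_cast; ring
    have e2 : (4 : ZMod n) - i + (i : ZMod n) = ((4 : ℤ) : ZMod n) := by push_cast; ring
    simp only [e1, e2] at h3
    rw [h3, glider_cast n hn 4 (by omega) (by omega)]
  have k0 := key 0
  have k1 := key 1
  have hval : ((4 : ZMod n) + (m : ZMod n)).val = 4 := by
    unfold glider at k0 k1
    simp only at k0 k1
    generalize ((4 : ZMod n) + (m : ZMod n)).val = y at k0 k1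
    by_contra hy
    have hy' : ¬ ((y : ℤ) = 4) := by omega
    unfold pat at k0 k1
    simp only [hy', if_false] at k0 k1
    split_ifs at k0 k1 <;> simp at k0 k1
  have h5 : (4 : ZMod n) + (m : ZMod n) = 4 := by
    rw [← ZMod.natCast_zmod_val ((4 : ZMod n) + (m : ZMod n)), hval]
    norm_num
  rw [← ZMod.natCast_eq_zero_iff]
  linear_combination h5

theorem exists_repeat {W : Type*} [Fintype W] (H : SimpleGraph W) (w : ℝ) (c : W → Strategy) :
    ∃ m, 1 < m ∧ ∃ i, configSeq H w c (i + m) = configSeq H w c i := by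
  have : Finite Strategy := Finite.of_injective (fun s : Strategy => decide (s = Strategy.C)) (by
    intro a b; cases a <;> cases b <;> simp)
  obtain ⟨x, y, hxy, he⟩ :=
    Finite.exists_ne_map_eq_of_infinite (fun t : ℕ => configSeq H w c (2 * t))
  rcases lt_or_gt_of_ne hxy with h | h
  · refine ⟨2 * y - 2 * x, by omega, 2 * x, ?_⟩
    rw [show 2 * x + (2 * y - 2 * x) = 2 * y by omega]
    exact he.symm
  · refine ⟨2 * x - 2 * y, by omega, 2 * y, ?_⟩
    rw [show 2 * y + (2 * x - 2 * y) = 2 * x by omega]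
    exact he

/-- For every positive integer `k` and every finite simple graph
`S` there exist a finite simple graph `G` containing `S` as an induced subgraph and
an initial configuration on `G` from which the `1/2`-power index process is
eventually periodic with period at least `k`. -/
theorem statement14 (k : ℕ) (hk : 0 < k) {U : Type} [Fintype U] (S : SimpleGraph U) :
    ∃ (m : ℕ) (G : SimpleGraph (Fin m)) (_ : S ↪g G) (c0 : Fin m → Strategy) (ℓ : ℕ),
      k ≤ ℓ ∧ EventuallyPeriodicWithPeriod G (1 / 2) c0 ℓ := by
  classical
  let n := k + 10
  have hn : 10 ≤ n := by omega
  let W := U ⊕ (ZMod n × Fin 3)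
  let GW : SimpleGraph W := S ⊕g ring3 n
  let e : W ≃ Fin (Fintype.card W) := Fintype.equivFin W
  let H : SimpleGraph (Fin (Fintype.card W)) := GW.map e.toEmbedding
  let iso : GW ≃g H := SimpleGraph.Iso.map e GW
  let f : ZMod n × Fin 3 ↪ Fin (Fintype.card W) :=
    ⟨fun x => iso (Sum.inr x), fun x y h => Sum.inr_injective (iso.injective h)⟩
  have hf : ∀ v, closedNbhd H (f v) = (closedNbhd (ring3 n) v).map f := by
    intro v
    ext u
    obtain ⟨u, rfl⟩ := iso.surjective u
    simp only [closedNbhd, Finset.mem_filter, Finset.mem_univ, true_and, Finset.mem_map]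
    change (iso u = iso (Sum.inr v) ∨ H.Adj (iso u) (iso (Sum.inr v))) ↔
      ∃ a, (a = v ∨ (ring3 n).Adj a v) ∧ iso (Sum.inr a) = iso u
    rw [iso.map_adj_iff, iso.injective.eq_iff]
    simp only [iso.injective.eq_iff]
    rcases u with u | u
    · simp [GW]
    · have hinr : ∀ a b : ZMod n × Fin 3, (Sum.inr a : W) = Sum.inr b ↔ a = b :=
        fun a b => Sum.inr_injective.eq_iff
      simp only [hinr, exists_eq_right]
      simp [GW]
  let c0 : Fin (Fintype.card W) → Strategy := fun x =>
    match iso.symm x with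
    | Sum.inl _ => Strategy.C
    | Sum.inr y => toS (glider n y)
  have hc0 : (fun x => c0 (f x)) = fun x => toS (glider n x) := by
    funext x
    have : iso.symm (f x) = Sum.inr x := iso.symm_apply_apply _
    simp only [c0, this]
  have hex := exists_repeat H (1 / 2) c0
  refine ⟨Fintype.card W, H, iso.toEmbedding.comp SimpleGraph.Embedding.sumInl, c0,
    Nat.find hex, ?_, Nat.find_spec hex, fun m hm => Nat.find_min' hex hm⟩
  obtain ⟨h1, i, hi⟩ := Nat.find_spec hex
  generalize Nat.find hex = m at h1 hi
  have h2 : (fun v => configSeq H (1 / 2) c0 (i + m) (f v)) =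
      fun v => configSeq H (1 / 2) c0 i (f v) := by rw [hi]
  rw [configSeq_emb (ring3 n) H f hf, configSeq_emb (ring3 n) H f hf, hc0] at h2
  have := Nat.le_of_dvd (by omega) (glider_period n hn i m h2)
  omega
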